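/- There exists a positive semidefinite matrix ρ indexed by Fin 9 × Fin 9 over ℂ such that ρ is PPT, SN(ρ) ≤ 5, and ¬(SN(ρ) ≤ 4); that is, in local dimensions 9 × 9 a PPT state of Schmidt number exactly 5 exists. -/

import Mathlib

open Matrix Kronecker ComplexOrder

/-- The Schmidt rank of a vector `ψ ∈ ℂ^(Fin m × Fin n)`: the rank of the associated
`m × n` matrix with `(i,j)` entry `ψ (i,j)`. -/
noncomputable def schmidtRank {m n : ℕ} (ψ : Fin m × Fin n → ℂ) : ℕ :=
  (Matrix.of fun i j => ψ (i, j) : Matrix (Fin m) (Fin n) ℂ).rank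

/-- Rank-one outer product `v v*`. -/
def outer {d : Type*} (v : d → ℂ) : Matrix d d ℂ :=
  Matrix.of fun a b => v a * star (v b)

/-- `SNle ρ k` : the Schmidt number of `ρ` is at most `k`, i.e. `ρ` is a finite sum of
outer products of vectors of Schmidt rank at most `k`. -/
def SNle {m n : ℕ} (ρ : Matrix (Fin m × Fin n) (Fin m × Fin n) ℂ) (k : ℕ) : Prop :=
  ∃ (T : ℕ) (v : Fin T → (Fin m × Fin n → ℂ)),
    (∀ t, schmidtRank (v t) ≤ k) ∧ ρ = ∑ t, outer (v t)

/-- Partial transpose on the second (B) subsystem. -/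
def ptB {m n : ℕ} (ρ : Matrix (Fin m × Fin n) (Fin m × Fin n) ℂ) :
    Matrix (Fin m × Fin n) (Fin m × Fin n) ℂ :=
  Matrix.of fun p q => ρ (p.1, q.2) (q.1, p.2)

/-- Partial transpose on the first (A) subsystem. -/
def ptA {m n : ℕ} (ρ : Matrix (Fin m × Fin n) (Fin m × Fin n) ℂ) :
    Matrix (Fin m × Fin n) (Fin m × Fin n) ℂ :=
  Matrix.of fun p q => ρ (q.1, p.2) (p.1, q.2)



theorem aux_exists_algInd : ∃ Ψ : Fin 9 × Fin 9 → ℂ, AlgebraicIndependent ℚ Ψ := by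
  obtain ⟨s, hs⟩ := exists_isTranscendenceBasis ℚ ℂ
  have h1 : Infinite s := by
    by_contra hfin
    rw [not_infinite_iff_finite] at hfin
    have h := IsAlgClosed.cardinal_le_max_transcendence_basis (R := ℚ) (K := ℂ) _ hs
    have h2 : Cardinal.mk ℂ ≤ Cardinal.aleph0 := by
      simpa using h
    exact absurd h2 (not_le.mpr (by rw [Cardinal.mk_complex]; exact Cardinal.aleph0_lt_continuum))
  obtain ⟨f⟩ : Nonempty (Fin 9 × Fin 9 ↪ s) := by
    refine ⟨(Encodable.encode' _).trans (Infinite.natEmbedding s)⟩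
  exact ⟨_, hs.1.comp f f.injective⟩

theorem aux_card {ι : Type} [Fintype ι] (g : ι → ℂ) (Ψ : Fin 9 × Fin 9 → ℂ)
    (h : AlgebraicIndependent ℚ Ψ) (hm : ∀ p, Ψ p ∈ Algebra.adjoin ℚ (Set.range g)) :
    81 ≤ Fintype.card ι := by
  let A := Algebra.adjoin ℚ (Set.range g)
  have h1 : AlgebraicIndependent ℚ (fun p => (⟨Ψ p, hm p⟩ : A)) :=
    AlgebraicIndependent.of_comp A.val h
  have h2 := h1.cardinalMk_le_trdeg
  let φ : MvPolynomial ι ℚ →ₐ[ℚ] A := (MvPolynomial.aeval (fun i => (⟨g i, Algebra.subset_adjoin ⟨i, rfl⟩⟩ : A)))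
  have hφ : Function.Surjective φ := by
    rintro ⟨x, hx⟩
    have hx' : x ∈ Algebra.adjoin ℚ (Set.range g) := hx
    rw [Algebra.adjoin_range_eq_range_aeval] at hx'
    obtain ⟨q, hq⟩ := hx'
    refine ⟨q, Subtype.ext ?_⟩
    rw [← Subalgebra.coe_val, ← AlgHom.comp_apply]
    have hc : A.val.comp φ = MvPolynomial.aeval g := by
      ext i
      simp [φ]
    rw [hc]
    exact hq
  have h3 := _root_.trdeg_le_of_surjective φ hφ
  rw [MvPolynomial.trdeg_of_isDomain] at h3
  have := h2.trans h3
  rw [Cardinal.mk_fintype, Cardinal.mk_fintype, Cardinal.lift_natCast, Nat.cast_le] at this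
  exact this

/-- Hankel matrices. -/
def aux_hankel (h : Fin 17 → ℂ) : Matrix (Fin 9) (Fin 9) ℂ :=
  Matrix.of fun i j => h ⟨i.1 + j.1, by omega⟩

theorem aux_rows (M : Matrix (Fin 9) (Fin 9) ℂ) (hM : M.rank ≤ 4) :
    ∃ R : Finset (Fin 9), R.card ≤ 4 ∧ ∃ A : Fin 9 → Fin 9 → ℂ,
      ∀ i j, M i j = ∑ k ∈ R, A i k * M k j := by
  classical
  obtain ⟨κ, a, ha, hsp, hli⟩ := exists_linearIndependent' ℂ M.row
  have : Finite κ := Finite.of_injective a ha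
  have := Fintype.ofFinite κ
  refine ⟨Finset.univ.image a, ?_, ?_⟩
  · rw [Matrix.rank_eq_finrank_span_row, ← hsp, finrank_span_eq_card hli] at hM
    exact Finset.card_image_le.trans hM
  · have : ∀ i, ∃ c : Fin 9 → ℂ, ∀ j, M i j = ∑ k ∈ Finset.univ.image a, c k * M k j := by
      intro i
      have hi : M.row i ∈ Submodule.span ℂ (Set.range (M.row ∘ a)) := by
        rw [hsp]; exact Submodule.subset_span ⟨i, rfl⟩
      obtain ⟨c, hc⟩ := (Submodule.mem_span_range_iff_exists_fun ℂ).1 hi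
      refine ⟨Function.extend a c 0, fun j => ?_⟩
      rw [Finset.sum_image (fun x _ y _ h => ha h)]
      have := congrFun hc j
      simp only [ha.extend_apply]
      simpa [Finset.sum_apply, eq_comm] using this
    choose A hA using this
    exact ⟨A, hA⟩

theorem aux_generic (Ψ : Fin 9 × Fin 9 → ℂ) (h : AlgebraicIndependent ℚ Ψ) (η : Fin 17 → ℂ) :
    4 < ((Matrix.of fun i j => Ψ (i, j)) + aux_hankel η).rank := by
  classical
  by_contra hM
  push Not at hM
  set M := (Matrix.of fun i j => Ψ (i, j)) + aux_hankel η with hMdef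
  obtain ⟨R, hR, A, hA⟩ := aux_rows M hM
  let g : ((↥(Rᶜ) × ↥R) ⊕ (↥R × Fin 9)) ⊕ Fin 17 → ℂ :=
    Sum.elim (Sum.elim (fun p => A p.1 p.2) (fun p => M p.1 p.2)) η
  have key := aux_card g Ψ h ?_
  · simp only [Fintype.card_sum, Fintype.card_prod, Fintype.card_coe, Finset.card_compl, Fintype.card_fin] at key
    generalize R.card = r at *
    interval_cases r <;> omega
  · rintro ⟨i, j⟩
    have e : Ψ (i, j) = M i j - η ⟨i.1 + j.1, by omega⟩ := by
      simp [hMdef, aux_hankel]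
    rw [e]
    have hg : ∀ x, g x ∈ Algebra.adjoin ℚ (Set.range g) := fun x => Algebra.subset_adjoin ⟨x, rfl⟩
    have hRM : ∀ k ∈ R, ∀ j, M k j ∈ Algebra.adjoin ℚ (Set.range g) := fun k hk j =>
      hg (Sum.inl (Sum.inr (⟨k, hk⟩, j)))
    refine sub_mem ?_ (hg (Sum.inr _))
    by_cases hi : i ∈ R
    · exact hRM i hi j
    · rw [hA]
      refine sum_mem fun k hk => mul_mem ?_ (hRM k hk j)
      exact hg (Sum.inl (Sum.inl (⟨i, by simpa using hi⟩, ⟨k, hk⟩)))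

theorem aux_rank_add (A B : Matrix (Fin 9) (Fin 9) ℂ) : (A + B).rank ≤ A.rank + B.rank := by
  have h : (A + B).rank = Module.finrank ℂ (LinearMap.range (A.mulVecLin + B.mulVecLin)) := by
    rw [← Matrix.mulVecLin_add]; rfl
  rw [h]
  have h2 : LinearMap.range (A.mulVecLin + B.mulVecLin) ≤
      LinearMap.range A.mulVecLin ⊔ LinearMap.range B.mulVecLin := by
    rintro _ ⟨x, rfl⟩
    exact Submodule.add_mem_sup ⟨x, rfl⟩ ⟨x, rfl⟩
  refine (Submodule.finrank_mono h2).trans ?_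
  exact Submodule.finrank_add_le_finrank_add_finrank _ _

theorem aux_psi : ∃ (ψ : Matrix (Fin 9) (Fin 9) ℂ), ψ.rank ≤ 5 ∧
    ∀ η, 4 < (ψ + aux_hankel η).rank := by
  classical
  obtain ⟨Ψ, hΨ⟩ := aux_exists_algInd
  let F : ℕ → Matrix (Fin 9) (Fin 9) ℂ := fun m => Matrix.of fun i j => if i.1 < m then Ψ (i, j) else 0
  have h9 : ∀ η, 4 < (F 9 + aux_hankel η).rank := by
    intro η
    have : F 9 = Matrix.of fun i j => Ψ (i, j) := by
      ext i j; simp [F]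
    rw [this]; exact aux_generic Ψ hΨ η
  have hex : ∃ m, ∀ η, 4 < (F m + aux_hankel η).rank := ⟨9, h9⟩
  have hs := Nat.find_spec hex
  obtain ⟨m, hm⟩ : ∃ m, Nat.find hex = m + 1 := by
    refine Nat.exists_eq_succ_of_ne_zero fun h0 => ?_
    rw [h0] at hs
    have := hs 0
    have e : F 0 + aux_hankel 0 = 0 := by ext i j; simp [F, aux_hankel]
    rw [e, Matrix.rank_zero] at this
    omega
  have hn := Nat.find_min hex (m := m) (by omega)
  rw [hm] at hs
  push Not at hn
  obtain ⟨η, hη⟩ := hn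
  refine ⟨F (m+1) + aux_hankel η, ?_, fun η' => ?_⟩
  · have e : F (m+1) + aux_hankel η = (F m + aux_hankel η) +
      Matrix.vecMulVec (fun i : Fin 9 => if i.1 = m then (1:ℂ) else 0)
        (fun j => if hm : m < 9 then Ψ (⟨m, hm⟩, j) else 0) := by
      ext i j
      simp only [F, Matrix.add_apply, Matrix.of_apply, Matrix.vecMulVec_apply]
      rcases lt_trichotomy i.1 m with h | h | h
      · simp [h, h.ne, Nat.lt_succ_of_lt h]
      · subst h; simp; ring
      · simp [h.ne', show ¬ i.1 < m by omega, show ¬ i.1 < m + 1 by omega]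
    rw [e]
    refine (aux_rank_add _ _).trans ?_
    have := Matrix.rank_vecMulVec_le (fun i : Fin 9 => if i.1 = m then (1:ℂ) else 0)
        (fun j => if hm : m < 9 then Ψ (⟨m, hm⟩, j) else 0)
    omega
  · have e : F (m+1) + aux_hankel η + aux_hankel η' = F (m+1) + aux_hankel (η + η') := by
      ext i j; simp [aux_hankel]; ring
    rw [e]; exact hs _

theorem aux_bound {d : Type} [Fintype d] [DecidableEq d] (H : Matrix d d ℂ) (hH : H.IsHermitian) :
    ∃ C : ℝ, 0 ≤ C ∧ ((C : ℂ) • (1 : Matrix d d ℂ) + H).PosSemidef := by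
  refine ⟨∑ a, ∑ b, ‖H a b‖, by positivity, ?_⟩
  set C := ∑ a, ∑ b, ‖H a b‖ with hC
  have hherm : ((C : ℂ) • (1 : Matrix d d ℂ) + H).IsHermitian := by
    refine Matrix.IsHermitian.add ?_ hH
    ext i j
    by_cases h : i = j
    · subst h; simp [Matrix.conjTranspose_apply]
    · simp [Matrix.conjTranspose_apply, Matrix.one_apply_ne h, Matrix.one_apply_ne (Ne.symm h)]
  refine Matrix.PosSemidef.of_dotProduct_mulVec_nonneg hherm fun x => ?_
  have him : (star x ⬝ᵥ ((C : ℂ) • (1 : Matrix d d ℂ) + H) *ᵥ x).im = 0 :=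
    hherm.im_star_dotProduct_mulVec_self x
  rw [Complex.le_def]
  refine ⟨?_, by simpa using him.symm⟩
  have e1 : star x ⬝ᵥ ((C : ℂ) • (1 : Matrix d d ℂ) + H) *ᵥ x =
      ((C * ∑ a, ‖x a‖ ^ 2 : ℝ) : ℂ) + ∑ a, ∑ b, star (x a) * H a b * x b := by
    rw [Matrix.add_mulVec, dotProduct_add, Matrix.smul_mulVec, Matrix.one_mulVec, dotProduct_smul]
    congr 1
    · simp only [dotProduct, Pi.star_apply, smul_eq_mul]
      push_cast
      congr 1
      refine Finset.sum_congr rfl fun a _ => ?_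
      rw [← Complex.conj_mul']; rfl
    · simp [dotProduct, Matrix.mulVec, Finset.mul_sum, mul_assoc]
  rw [e1, Complex.add_re, Complex.ofReal_re]
  have h2 : ‖∑ a, ∑ b, star (x a) * H a b * x b‖ ≤ C * ∑ a, ‖x a‖ ^ 2 := by
    refine (norm_sum_le _ _).trans ?_
    rw [hC, Finset.sum_mul]
    refine Finset.sum_le_sum fun a _ => ?_
    refine (norm_sum_le _ _).trans ?_
    rw [Finset.sum_mul]
    refine Finset.sum_le_sum fun b _ => ?_
    rw [norm_mul, norm_mul, norm_star]
    have ha : ‖x a‖ ^ 2 ≤ ∑ a, ‖x a‖ ^ 2 :=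
      Finset.single_le_sum (f := fun a => ‖x a‖ ^ 2) (fun _ _ => by positivity) (Finset.mem_univ a)
    have hb : ‖x b‖ ^ 2 ≤ ∑ a, ‖x a‖ ^ 2 :=
      Finset.single_le_sum (f := fun a => ‖x a‖ ^ 2) (fun _ _ => by positivity) (Finset.mem_univ b)
    have : ‖x a‖ * ‖x b‖ ≤ ∑ a, ‖x a‖ ^ 2 := by nlinarith [sq_nonneg (‖x a‖ - ‖x b‖)]
    calc _ = ‖H a b‖ * (‖x a‖ * ‖x b‖) := by ring
      _ ≤ _ := mul_le_mul_of_nonneg_left this (norm_nonneg _)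
  have h3 := Complex.abs_re_le_norm (∑ a, ∑ b, star (x a) * H a b * x b)
  have h4 := neg_abs_le (∑ a, ∑ b, star (x a) * H a b * x b).re
  simp only [Complex.zero_re]
  linarith

/-- base point -/
def aux_z : ℂ := ⟨1, 2⟩

/-- Vandermonde nodes -/
def aux_node (q : Fin 9 × Fin 9) : ℂ := star aux_z ^ q.1.1 * aux_z ^ q.2.1

theorem aux_pow_ne : ∀ n : Fin 9, n ≠ 0 → star aux_z ^ n.1 ≠ aux_z ^ n.1 := by
  intro n hn h
  have : (star aux_z ^ n.1).im = (aux_z ^ n.1).im := by rw [h]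
  fin_cases n <;> first
    | exact hn rfl
    | (simp [aux_z, pow_succ, Complex.mul_im, Complex.mul_re] at this; try norm_num at this)

theorem aux_node_inj : Function.Injective aux_node := by
  have hz : aux_z ≠ 0 := by intro h; have := congrArg Complex.re h; simp [aux_z] at this
  have hz' : star aux_z ≠ 0 := by simpa using hz
  have hnz : Complex.normSq aux_z = 5 := by simp [aux_z, Complex.normSq_apply]; norm_num
  rintro ⟨a, b⟩ ⟨c, d⟩ h
  simp only [aux_node] at h
  have h1 : a.1 + b.1 = c.1 + d.1 := by
    have := congrArg Complex.normSq h
    simp only [map_mul, map_pow, RCLike.star_def, Complex.normSq_conj, hnz, ← pow_add] at this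
    exact pow_right_injective₀ (by norm_num) (by norm_num) this
  have main : ∀ a b c d : Fin 9, a.1 + b.1 = c.1 + d.1 → a < c →
      star aux_z ^ a.1 * aux_z ^ b.1 = star aux_z ^ c.1 * aux_z ^ d.1 → False := by
    intro a b c d h1 hlt h
    have hb : b.1 = d.1 + (c.1 - a.1) := by omega
    have hc : c.1 = a.1 + (c.1 - a.1) := by omega
    rw [hb, hc, pow_add, pow_add] at h
    simp only [Nat.add_sub_cancel_left] at h
    have h5 : star aux_z ^ a.1 * aux_z ^ d.1 * (star aux_z ^ (c.1 - a.1)) =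
      star aux_z ^ a.1 * aux_z ^ d.1 * (aux_z ^ (c.1 - a.1)) := by linear_combination -h
    have h6 := mul_left_cancel₀ (mul_ne_zero (pow_ne_zero _ hz') (pow_ne_zero _ hz)) h5
    exact aux_pow_ne ⟨c.1 - a.1, by omega⟩ (by simp [Fin.ext_iff]; omega) h6
  rcases lt_trichotomy a c with h2 | h2 | h2
  · exact (main a b c d h1 h2 h).elim
  · subst h2; ext <;> simp; omega
  · exact (main c d a b h1.symm h2 h.symm).elim

/-- row numbering -/
def aux_num (p : Fin 9 × Fin 9) : ℕ := (finProdFinEquiv p).1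

/-- Vandermonde matrix -/
def aux_B : Matrix (Fin 9 × Fin 9) (Fin 9 × Fin 9) ℂ :=
  Matrix.of fun p q => aux_node q ^ aux_num p

theorem aux_B_unit : IsUnit aux_B.det := by
  have e : aux_B = ((Matrix.vandermonde (aux_node ∘ finProdFinEquiv.symm))ᵀ).submatrix
      finProdFinEquiv finProdFinEquiv := by
    ext p q
    simp only [aux_B, aux_num, Matrix.of_apply, Matrix.submatrix_apply, Matrix.transpose_apply,
      Matrix.vandermonde_apply, Function.comp_apply, Equiv.symm_apply_apply]
  rw [e, Matrix.det_submatrix_equiv_self, Matrix.det_transpose, isUnit_iff_ne_zero,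
    Matrix.det_vandermonde_ne_zero_iff]
  exact aux_node_inj.comp finProdFinEquiv.symm.injective

/-- product vectors on the rational normal curve -/
def aux_v (p : Fin 9 × Fin 9) (a : Fin 9 × Fin 9) : ℂ := (aux_z ^ aux_num p) ^ (a.1.1 + a.2.1)

theorem aux_pt_v : ptB (∑ p, outer (aux_v p)) = aux_Bᴴ * aux_B := by
  ext a b
  simp only [ptB, outer, Matrix.of_apply, Matrix.sum_apply, Matrix.mul_apply,
    Matrix.conjTranspose_apply]
  refine Finset.sum_congr rfl fun p _ => ?_
  simp only [aux_v, aux_B, aux_node, Matrix.of_apply, star_pow, star_mul', star_star]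
  ring

theorem aux_pt_herm (ψ : Fin 9 × Fin 9 → ℂ) : (ptB (outer ψ)).IsHermitian := by
  ext a b
  simp [ptB, outer, Matrix.conjTranspose_apply, mul_comm]

theorem aux_ppt (ψ : Fin 9 × Fin 9 → ℂ) : ∃ C : ℝ, 0 ≤ C ∧
    (ptB ((C : ℂ) • (∑ p, outer (aux_v p)) + outer ψ)).PosSemidef := by
  obtain ⟨C, hC, h⟩ := aux_bound ((aux_B⁻¹)ᴴ * ptB (outer ψ) * aux_B⁻¹)
    (Matrix.isHermitian_conjTranspose_mul_mul _ (aux_pt_herm ψ))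
  refine ⟨C, hC, ?_⟩
  have h2 := h.conjTranspose_mul_mul_same aux_B
  have e : ptB ((C : ℂ) • (∑ p, outer (aux_v p)) + outer ψ) =
      (C : ℂ) • ptB (∑ p, outer (aux_v p)) + ptB (outer ψ) := by
    ext a b; simp [ptB]
  rw [e, aux_pt_v]
  convert h2 using 1
  have hB : aux_B⁻¹ * aux_B = 1 := Matrix.nonsing_inv_mul _ aux_B_unit
  have hB' : aux_Bᴴ * (aux_B⁻¹)ᴴ = 1 := by
    rw [← Matrix.conjTranspose_mul, hB, Matrix.conjTranspose_one]
  rw [Matrix.mul_add, Matrix.add_mul, Matrix.mul_smul, Matrix.mul_one, Matrix.smul_mul]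
  congr 1
  calc ptB (outer ψ) = (aux_Bᴴ * (aux_B⁻¹)ᴴ) * ptB (outer ψ) * (aux_B⁻¹ * aux_B) := by
        rw [hB, hB', Matrix.one_mul, Matrix.mul_one]
    _ = _ := by simp only [Matrix.mul_assoc]

theorem aux_outer_psd {d : Type} [Fintype d] (v : d → ℂ) : (outer v).PosSemidef := 
  Matrix.posSemidef_vecMulVec_self_star v

/-- Hankel vectors -/
def aux_U : Submodule ℂ (Fin 9 × Fin 9 → ℂ) where
  carrier := {u | ∃ η, ∀ i j, u (i, j) = aux_hankel η i j}
  add_mem' := by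
    rintro u w ⟨η, h⟩ ⟨θ, h'⟩
    exact ⟨η + θ, fun i j => by simp [h, h', aux_hankel]⟩
  zero_mem' := ⟨0, fun i j => by simp [aux_hankel]⟩
  smul_mem' := by
    rintro c u ⟨η, h⟩
    exact ⟨c • η, fun i j => by simp [h, aux_hankel]⟩

theorem aux_quad (f : (Fin 9 × Fin 9 → ℂ) →ₗ[ℂ] ℂ) : ∃ Q : Matrix (Fin 9 × Fin 9) (Fin 9 × Fin 9) ℂ →ₗ[ℂ] ℂ,
    ∀ v, Q (outer v) = ((‖f v‖ ^ 2 : ℝ) : ℂ) := by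
  classical
  let y : Fin 9 × Fin 9 → ℂ := fun a => f (Pi.single a 1)
  have hf : ∀ v, f v = ∑ a, v a * y a := fun v => by
    rw [LinearMap.pi_apply_eq_sum_univ f v]
    refine Finset.sum_congr rfl fun a _ => ?_
    simp only [smul_eq_mul, y]
    congr 2
    ext b
    simp [Pi.single_apply, eq_comm]
  refine ⟨{ toFun := fun M => ∑ a, ∑ b, M a b * y a * star (y b), map_add' := ?_, map_smul' := ?_ }, ?_⟩
  · intro M N
    simp only [Matrix.add_apply, add_mul, Finset.sum_add_distrib]
  · intro c M
    simp only [Matrix.smul_apply, smul_eq_mul, Finset.mul_sum, RingHom.id_apply, mul_assoc]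
  · intro v
    have : ((‖f v‖ ^ 2 : ℝ) : ℂ) = f v * star (f v) := by
      push_cast; rw [← Complex.mul_conj']; rfl
    rw [this, hf, star_sum, Finset.sum_mul_sum]
    simp only [LinearMap.coe_mk, AddHom.coe_mk, outer, Matrix.of_apply, star_mul']
    refine Finset.sum_congr rfl fun a _ => Finset.sum_congr rfl fun b _ => ?_
    ring

theorem aux_smul_outer (C : ℝ) (hC : 0 ≤ C) (v : Fin 9 × Fin 9 → ℂ) :
    (C : ℂ) • outer v = outer ((Real.sqrt C : ℂ) • v) := by
  ext a b
  have : (C : ℂ) = (Real.sqrt C : ℂ) * (Real.sqrt C : ℂ) := by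
    rw [← Complex.ofReal_mul, Real.mul_self_sqrt hC]
  simp only [outer, Matrix.smul_apply, Matrix.of_apply, Pi.smul_apply, smul_eq_mul, star_mul']
  rw [this]
  simp [Complex.conj_ofReal]
  ring

theorem aux_v_mem (p) : aux_v p ∈ aux_U :=
  ⟨fun s => (aux_z ^ aux_num p) ^ s.1, fun i j => by simp [aux_v, aux_hankel]⟩

theorem aux_v_rank (p) (c : ℂ) : schmidtRank (c • aux_v p) ≤ 1 := by
  have : (Matrix.of fun i j => (c • aux_v p) (i, j) : Matrix (Fin 9) (Fin 9) ℂ) =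
      Matrix.vecMulVec (fun i => c * (aux_z ^ aux_num p) ^ i.1) (fun j => (aux_z ^ aux_num p) ^ j.1) := by
    ext i j
    simp [aux_v, Matrix.vecMulVec_apply, pow_add, mul_assoc]
  rw [schmidtRank, this]
  exact Matrix.rank_vecMulVec_le _ _

/-- In local dimensions 9 × 9 a PPT state of Schmidt number exactly 5 exists. -/
theorem exists_ppt_9x9_schmidt_number_five :
    ∃ ρ : Matrix (Fin 9 × Fin 9) (Fin 9 × Fin 9) ℂ,
      ρ.PosSemidef ∧ (ptB ρ).PosSemidef ∧ SNle ρ 5 ∧ ¬ SNle ρ 4 := by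
  obtain ⟨Φ, hΦ5, hΦ⟩ := aux_psi
  let ψ : Fin 9 × Fin 9 → ℂ := fun p => Φ p.1 p.2
  have hψΦ : (Matrix.of fun i j => ψ (i, j)) = Φ := rfl
  have hψU : ψ ∉ aux_U := by
    rintro ⟨η, hη⟩
    have := hΦ (-η)
    have e : Φ + aux_hankel (-η) = 0 := by
      ext i j
      have := hη i j
      simp only [ψ, aux_hankel, Matrix.of_apply] at this
      simp [aux_hankel, this]
    rw [e, Matrix.rank_zero] at this
    omega
  obtain ⟨C, hC, hppt⟩ := aux_ppt ψ
  refine ⟨_, ?_, hppt, ?_, ?_⟩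
  · refine Matrix.PosSemidef.add ?_ (aux_outer_psd ψ)
    rw [Finset.smul_sum]
    refine Matrix.posSemidef_sum _ fun p _ => ?_
    rw [aux_smul_outer C hC]
    exact aux_outer_psd _
  · refine ⟨81 + 1, Fin.snoc (fun k => (Real.sqrt C : ℂ) • aux_v ((finProdFinEquiv (m := 9) (n := 9)).symm k)) ψ, ?_, ?_⟩
    · intro t
      refine Fin.lastCases ?_ (fun k => ?_) t
      · rw [Fin.snoc_last]; exact hΦ5
      · rw [Fin.snoc_castSucc]; exact (aux_v_rank _ _).trans (by norm_num)
    · rw [Fin.sum_univ_castSucc]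
      simp only [Fin.snoc_last, Fin.snoc_castSucc, ← aux_smul_outer C hC]
      rw [Finset.smul_sum]
      exact congrArg (· + outer ψ) (Equiv.sum_comp (finProdFinEquiv (m := 9) (n := 9)).symm
        (fun p => (C : ℂ) • outer (aux_v p))).symm
  · rintro ⟨T, u, hu, hρ⟩
    have key : ∀ f : (Fin 9 × Fin 9 → ℂ) →ₗ[ℂ] ℂ, aux_U ≤ LinearMap.ker f →
        ‖f ψ‖ ^ 2 = ∑ t, ‖f (u t)‖ ^ 2 := by
      intro f hf
      obtain ⟨Q, hQ⟩ := aux_quad f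
      have := congrArg Q hρ
      rw [map_add, map_smul, map_sum, map_sum] at this
      simp only [hQ] at this
      have h0 : ∀ p, f (aux_v p) = 0 := fun p => hf (aux_v_mem p)
      simp only [h0] at this
      norm_num at this
      exact_mod_cast this
    have hmem : ∀ t, u t ∈ aux_U := by
      intro t
      have h1 : u t ∈ aux_U ⊔ Submodule.span ℂ {ψ} := by
        by_contra hn
        obtain ⟨f, hf0, hf⟩ := Submodule.exists_le_ker_of_notMem hn
        have h2 := key f (le_sup_left.trans hf)
        have h3 : f ψ = 0 := hf (Submodule.mem_sup_right (Submodule.mem_span_singleton_self ψ))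
        rw [h3] at h2
        have h4 : ‖f (u t)‖ ^ 2 ≤ ∑ t, ‖f (u t)‖ ^ 2 :=
          Finset.single_le_sum (f := fun t => ‖f (u t)‖ ^ 2) (fun _ _ => by positivity) (Finset.mem_univ t)
        have h5 : 0 < ‖f (u t)‖ := norm_pos_iff.2 hf0
        simp at h2
        nlinarith
      obtain ⟨w, ⟨η, hη⟩, s, hs, hws⟩ := Submodule.mem_sup.1 h1
      obtain ⟨c, rfl⟩ := Submodule.mem_span_singleton.1 hs
      by_cases hc : c = 0
      · rw [← hws, hc, zero_smul, add_zero]; exact ⟨η, hη⟩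
      · exfalso
        have h6 := hu t
        have h7 := hΦ (c⁻¹ • η)
        have e : Φ + aux_hankel (c⁻¹ • η) =
            (c⁻¹ • (1 : Matrix (Fin 9) (Fin 9) ℂ)) * (Matrix.of fun i j => u t (i, j)) := by
          ext i j
          have h8 := hη i j
          simp only [aux_hankel, Matrix.of_apply] at h8
          simp [← hws, aux_hankel, h8, ψ]
          field_simp
          ring
        rw [e] at h7
        have h9 := h7.trans_le (Matrix.rank_mul_le_right _ _)
        simp only [schmidtRank] at h6
        omega
    obtain ⟨f, hf0, hf⟩ := Submodule.exists_le_ker_of_notMem hψU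
    have h2 := key f hf
    have h3 : ∀ t, f (u t) = 0 := fun t => hf (hmem t)
    simp [h3] at h2
    exact hf0 h2
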